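/- Let α < 1 and let Λ be a locally finite Borel measure on (0,∞) satisfying Λ(A) = Λ(mA) for every Borel set A ⊆ (0,∞). Then for every z ∈ [0,1) the integral G(z) = ∫₀^∞ (e^{(H(z)−1)x} − e^{−x})·x^{−α} Λ(dx) is finite, there exist nonnegative reals ν(n), n ≥ 1, such that G(z) = ∑_{n≥1} ν(n)·zⁿ for all z ∈ [0,1), and the measure ν on ℕ* so defined is m^α-invariant. -/

import Mathlib

open MeasureTheory Real Set

/-- `convPow q i j` is the `i`-fold convolution power of the offspring distribution `q`
evaluated at `j`, i.e. the transition matrix `P₀(i,j)` of the BGW process. -/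
noncomputable def convPow (q : ℕ → ℝ) : ℕ → ℕ → ℝ
  | 0, j => if j = 0 then 1 else 0
  | i + 1, j => ∑ k ∈ Finset.range (j + 1), convPow q i (j - k) * q k

/-- `ν` is a `lam`-invariant measure on `ℕ* = {1,2,…}` of the BGW process killed at 0. -/
def IsInvMeasure (q : ℕ → ℝ) (lam : ℝ) (ν : ℕ → ℝ) : Prop :=
  (∀ n, 0 ≤ ν n) ∧ ν 0 = 0 ∧
  ∀ j : ℕ, 1 ≤ j →
    Summable (fun i => ν i * convPow q i j) ∧
    ∑' i, ν i * convPow q i j = lam * ν j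

/-- `Λ` is a locally finite Borel measure on `(0,∞)` (viewed as a measure on `ℝ` giving
no mass to `(-∞,0]` and finite mass to compact subsets of `(0,∞)`). -/
def IsLocFiniteOnPos (Λ : Measure ℝ) : Prop :=
  Λ (Set.Iic 0) = 0 ∧ ∀ K : Set ℝ, IsCompact K → K ⊆ Set.Ioi 0 → Λ K < ⊤

/-- `Λ(A) = Λ(mA)` for every Borel set `A ⊆ (0,∞)`. -/
def ScaleInvariant (m : ℝ) (Λ : Measure ℝ) : Prop :=
  ∀ A : Set ℝ, MeasurableSet A → A ⊆ Set.Ioi 0 →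
    Λ A = Λ ((fun x => m * x) '' A)


lemma convPow_nonneg' {p : ℕ → ℝ} (hp : ∀ k, 0 ≤ p k) : ∀ i j, 0 ≤ convPow p i j
  | 0, j => by unfold convPow; split_ifs <;> norm_num
  | i + 1, j => by
    unfold convPow
    exact Finset.sum_nonneg fun k _ => mul_nonneg (convPow_nonneg' hp i _) (hp k)

lemma convPow_hasSum {p : ℕ → ℝ} (hp : ∀ k, 0 ≤ p k) {z S : ℝ} (hz : 0 ≤ z)
    (hS : HasSum (fun k => p k * z ^ k) S) :
    ∀ i, HasSum (fun j => convPow p i j * z ^ j) (S ^ i)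
  | 0 => by
    have := hasSum_ite_eq (α := ℝ) (0 : ℕ) (1 : ℝ)
    convert! this using 2 with j
    · unfold convPow; split_ifs with h <;> simp [h]
  | i + 1 => by
    have ih := convPow_hasSum hp hz hS i
    have h1 : Summable fun j => ‖p j * z ^ j‖ := hS.summable.norm
    have h2 : Summable fun j => ‖convPow p i j * z ^ j‖ := ih.summable.norm
    have := hasSum_sum_range_mul_of_summable_norm h1 h2
    rw [hS.tsum_eq, ih.tsum_eq] at this
    convert! this using 2 with j
    · rw [convPow, Finset.sum_mul]
      refine Finset.sum_congr rfl fun k hk => ?_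
      have hk' : k ≤ j := by simpa [Nat.lt_succ_iff] using hk
      have : z ^ j = z ^ k * z ^ (j - k) := by rw [← pow_add]; congr 1; omega
      rw [this]; ring
    · ring

lemma swap_hasSum {f : ℕ → ℕ → ℝ} (hf : ∀ i j, 0 ≤ f i j) {g : ℕ → ℝ} {T : ℝ}
    (h1 : ∀ i, HasSum (f i) (g i)) (h2 : HasSum g T) :
    (∀ j, Summable fun i => f i j) ∧ HasSum (fun j => ∑' i, f i j) T := by
  have hs : Summable (fun p : ℕ × ℕ => f p.1 p.2) := by
    refine (summable_prod_of_nonneg (fun p => hf p.1 p.2)).2 ⟨fun i => (h1 i).summable, ?_⟩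
    simpa only [(h1 _).tsum_eq] using h2.summable
  have hT : HasSum (fun p : ℕ × ℕ => f p.1 p.2) T := by
    have := hs.hasSum
    have h3 := this.prod_fiberwise h1
    rwa [h3.unique h2] at this
  have hT' : HasSum (fun p : ℕ × ℕ => f p.2 p.1) T :=
    (Equiv.prodComm ℕ ℕ).hasSum_iff.2 hT
  have h4 : ∀ j, Summable fun i => f i j := fun j => hT'.summable.prod_factor j
  exact ⟨h4, hT'.prod_fiberwise fun j => (h4 j).hasSum⟩

/-- Transport of a generating function through the transition matrix. -/
lemma gen_swap {q ν : ℕ → ℝ} (hq : ∀ k, 0 ≤ q k) (hν : ∀ k, 0 ≤ ν k) {z S T : ℝ} (hz : 0 ≤ z)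
    (hS : HasSum (fun k => q k * z ^ k) S) (hT : HasSum (fun i => ν i * S ^ i) T) :
    (z ≠ 0 → ∀ j, Summable fun i => ν i * convPow q i j) ∧
    HasSum (fun j => (∑' i, ν i * convPow q i j) * z ^ j) T := by
  have := swap_hasSum (f := fun i j => ν i * (convPow q i j * z ^ j))
    (fun i j => mul_nonneg (hν i) (mul_nonneg (convPow_nonneg' hq i j) (pow_nonneg hz j)))
    (fun i => (convPow_hasSum hq hz hS i).mul_left (ν i)) hT
  simp only [← mul_assoc] at this
  refine ⟨fun hz0 j => ?_, ?_⟩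
  · exact (summable_mul_right_iff (pow_ne_zero j hz0)).1 (this.1 j)
  · simpa only [tsum_mul_right] using this.2

lemma coeff_unique {a : ℕ → ℝ} (h : ∀ z ∈ Set.Ioo (0:ℝ) 1, HasSum (fun n => a n * z ^ n) 0) :
    ∀ n, a n = 0 := by
  set p := FormalMultilinearSeries.ofScalars ℝ a
  have hc : ∀ n, p.coeff n = a n := fun n => by simp [p, FormalMultilinearSeries.coeff_ofScalars]
  have hp : HasFPowerSeriesAt (fun z => ∑' n, z ^ n • p.coeff n) p 0 := by
    rw [hasFPowerSeriesAt_iff]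
    filter_upwards [Metric.ball_mem_nhds (0:ℝ) one_half_pos] with z hz
    rw [zero_add]
    refine Summable.hasSum ?_
    refine Summable.of_norm_bounded (h (1/2) (by norm_num)).summable.norm fun n => ?_
    rw [hc, smul_eq_mul, mul_comm, norm_mul, norm_mul, norm_pow, norm_pow]
    gcongr
    have : |z| < 1/2 := by simpa using hz
    simp only [Real.norm_eq_abs]
    rw [abs_of_pos (by norm_num : (0:ℝ) < 1/2)]
    exact this.le
  have hf : ∃ᶠ z in nhdsWithin (0:ℝ) {0}ᶜ, (∑' n, z ^ n • p.coeff n) = 0 := by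
    have : ∀ᶠ z in nhdsWithin (0:ℝ) (Set.Ioi 0), (∑' n, z ^ n • p.coeff n) = 0 := by
      filter_upwards [Ioo_mem_nhdsGT (zero_lt_one (α := ℝ))] with z hz
      have := (h z hz).tsum_eq
      simpa [hc, mul_comm] using this
    exact this.frequently.filter_mono (nhdsWithin_mono _ fun x hx => ne_of_gt hx)
  have he := (AnalyticAt.frequently_zero_iff_eventually_zero hp.analyticAt).1 hf
  have := (hp.congr he).eq_zero
  intro n
  rw [← hc, this]; rfl

lemma sm_map {m : ℝ} (hm0 : 0 < m) {Λ : Measure ℝ} (hs : ScaleInvariant m Λ) :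
    Measure.map (fun x => m * x) (Λ.restrict (Set.Ioi 0)) = Λ.restrict (Set.Ioi 0) := by
  ext A hA
  have hmeas : Measurable (fun x : ℝ => m * x) := measurable_const_mul m
  rw [Measure.map_apply hmeas hA, Measure.restrict_apply (hmeas hA), Measure.restrict_apply hA,
    hs _ ((hmeas hA).inter measurableSet_Ioi) Set.inter_subset_right]
  congr 1
  ext y
  constructor
  · rintro ⟨x, ⟨hx, hx0⟩, rfl⟩
    exact ⟨hx, mul_pos hm0 hx0⟩
  · rintro ⟨hy, hy0⟩
    have : m * (m⁻¹ * y) = y := by field_simp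
    exact ⟨m⁻¹ * y, ⟨by simpa [this] using hy, mul_pos (inv_pos.2 hm0) hy0⟩, this⟩

lemma geom_lint {Λ : Measure ℝ} {s : ℕ → Set ℝ} (hsm : ∀ k, MeasurableSet (s k)) {L : ENNReal}
    (hL : L ≠ ⊤) (hm : ∀ k, Λ (s k) = L) {f : ℝ → ENNReal} {C r : ℝ} (hr0 : 0 ≤ r) (hr : r < 1)
    (hC : 0 ≤ C) (hf : ∀ k, ∀ x ∈ s k, f x ≤ ENNReal.ofReal (C * r ^ k)) :
    ∫⁻ x in ⋃ k, s k, f x ∂Λ < ⊤ := by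
  refine (lintegral_iUnion_le _ _).trans_lt ?_
  have : ∀ k, ∫⁻ x in s k, f x ∂Λ ≤ ENNReal.ofReal (C * r ^ k) * L := fun k => by
    refine (setLIntegral_mono' (hsm k) (hf k)).trans ?_
    rw [setLIntegral_const, hm]
  refine (ENNReal.tsum_le_tsum this).trans_lt ?_
  rw [ENNReal.tsum_mul_right]
  refine ENNReal.mul_lt_top ?_ hL.lt_top
  rw [← ENNReal.ofReal_tsum_of_nonneg (fun k => by positivity)
    ((summable_geometric_of_lt_one hr0 hr).mul_left C)]
  exact ENNReal.ofReal_lt_top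

lemma exp_bd {β c : ℝ} (hc : 0 < c) :
    ∃ C, 0 ≤ C ∧ ∀ x : ℝ, 1 ≤ x → x ^ β * Real.exp (-(c * x)) ≤ C * x⁻¹ := by
  obtain ⟨n, hn⟩ := exists_nat_ge (β + 1)
  refine ⟨n.factorial / c ^ n, by positivity, fun x hx => ?_⟩
  have hx0 : 0 < x := by linarith
  have h1 : x ^ β * x ≤ x ^ n := by
    rw [← Real.rpow_add_one hx0.ne', ← Real.rpow_natCast]
    exact Real.rpow_le_rpow_of_exponent_le hx hn
  have h2 := Real.pow_div_factorial_le_exp (c * x) (by positivity) n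
  rw [Real.exp_neg, ← div_eq_mul_inv, ← div_eq_mul_inv, div_le_div_iff₀ (Real.exp_pos _) hx0]
  refine h1.trans ?_
  have : x ^ n = n.factorial / c ^ n * ((c * x) ^ n / n.factorial) := by
    rw [mul_pow]; field_simp
  rw [this]
  gcongr

lemma lint_fin {m : ℝ} (hm0 : 0 < m) (hm1 : m < 1) {Λ : Measure ℝ} (hΛ : IsLocFiniteOnPos Λ)
    (hs : ScaleInvariant m Λ) {β c : ℝ} (hβ : 0 < β) (hc : 0 < c) :
    ∫⁻ x in Set.Ioi (0:ℝ), ENNReal.ofReal (x ^ β * Real.exp (-(c * x))) ∂Λ < ⊤ := by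
  have hsc : ∀ a b : ℝ, 0 < a → Λ (Set.Ioc a b) = Λ (Set.Ioc (m * a) (m * b)) := fun a b ha => by
    rw [hs _ measurableSet_Ioc (fun x hx => ha.trans hx.1)]
    congr 1
    exact Set.image_mul_left_Ioc hm0 a b
  set L := Λ (Set.Ioc m 1)
  have hL : L ≠ ⊤ := by
    refine ne_top_of_le_ne_top (hΛ.2 (Set.Icc m 1) isCompact_Icc fun x hx => hm0.trans_le hx.1).ne
      (measure_mono Set.Ioc_subset_Icc_self)
  have hE : ∀ k : ℕ, Λ (Set.Ioc (m ^ (k + 1)) (m ^ k)) = L := by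
    intro k
    induction k with
    | zero => simp [L]
    | succ k ih =>
      rw [← ih, hsc (m ^ (k + 1)) (m ^ k) (by positivity), ← pow_succ', ← pow_succ']
  have hD : ∀ k : ℕ, Λ (Set.Ioc (m⁻¹ ^ k) (m⁻¹ ^ (k + 1))) = L := by
    intro k
    induction k with
    | zero => 
      rw [hsc _ _ (by positivity)]
      simp [L, hm0.ne']
    | succ k ih =>
      rw [← ih, hsc _ _ (by positivity), pow_succ' _ k, pow_succ' _ (k+1), pow_succ' _ k]
      congr 2 <;> field_simp
  have hcov : Set.Ioi (0:ℝ) ⊆ (⋃ k : ℕ, Set.Ioc (m ^ (k + 1)) (m ^ k)) ∪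
      ⋃ k : ℕ, Set.Ioc (m⁻¹ ^ k) (m⁻¹ ^ (k + 1)) := by
    intro x hx
    rcases le_or_gt x 1 with h | h
    · obtain ⟨n, h1, h2⟩ := exists_nat_pow_near_of_lt_one hx h hm0 hm1
      exact Or.inl (Set.mem_iUnion.2 ⟨n, h1, h2⟩)
    · right
      have hx0 : 0 < x := hx
      obtain ⟨n, hn⟩ : ∃ n : ℕ, x ≤ m⁻¹ ^ n :=
        (pow_unbounded_of_one_lt x (one_lt_inv_iff₀.2 ⟨hm0, hm1⟩)).imp fun _ h => h.le
      classical
      have hex : ∃ n : ℕ, x ≤ m⁻¹ ^ n := ⟨n, hn⟩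
      have h1 := Nat.find_spec hex
      have h0 : Nat.find hex ≠ 0 := by
        intro h0
        rw [h0] at h1
        simp at h1
        linarith
      obtain ⟨k, hk⟩ := Nat.exists_eq_succ_of_ne_zero h0
      refine Set.mem_iUnion.2 ⟨k, ?_, ?_⟩
      · have := Nat.find_min hex (m := k) (by omega)
        exact not_le.1 this
      · rw [hk] at h1; exact h1
  obtain ⟨C, hC0, hC⟩ := exp_bd (β := β) hc
  refine (lintegral_mono_set hcov).trans_lt ((lintegral_union_le _ _ _).trans_lt ?_)
  refine ENNReal.add_lt_top.2 ⟨?_, ?_⟩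
  · refine geom_lint (fun _ => measurableSet_Ioc) hL hE (C := 1) (r := m ^ β) (by positivity)
      (Real.rpow_lt_one hm0.le hm1 hβ) zero_le_one fun k x hx => ENNReal.ofReal_le_ofReal ?_
    have hx0 : 0 < x := lt_trans (by positivity) hx.1
    have h1 : Real.exp (-(c * x)) ≤ 1 := Real.exp_le_one_iff.2 (by nlinarith)
    have h2 : x ^ β ≤ (m ^ β) ^ k := by
      rw [← Real.rpow_natCast, ← Real.rpow_mul hm0.le, mul_comm, Real.rpow_mul hm0.le,
        Real.rpow_natCast]
      exact Real.rpow_le_rpow hx0.le hx.2 hβ.le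
    have h3 : 0 ≤ x ^ β := by positivity
    nlinarith
  · refine geom_lint (fun _ => measurableSet_Ioc) hL hD (C := C) (r := m) hm0.le hm1 hC0
      fun k x hx => ENNReal.ofReal_le_ofReal ?_
    have h1 : 1 ≤ m⁻¹ ^ k := one_le_pow₀ (one_le_inv_iff₀.2 ⟨hm0, hm1.le⟩)
    refine (hC x (h1.trans hx.1.le)).trans ?_
    gcongr
    have := inv_anti₀ (by positivity) hx.1.le
    simpa using this

/-- Coefficients of `exp (x H(z))`. -/
noncomputable def expCoef (p : ℕ → ℝ) (n : ℕ) (x : ℝ) : ℝ :=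
  ∑' k : ℕ, x ^ k / (k.factorial : ℝ) * convPow p k n

lemma expCoef_nonneg {p : ℕ → ℝ} (hp : ∀ k, 0 ≤ p k) (n : ℕ) {x : ℝ} (hx : 0 ≤ x) :
    0 ≤ expCoef p n x :=
  tsum_nonneg fun k => mul_nonneg (by positivity) (convPow_nonneg' hp k n)

lemma expCoef_hasSum {p : ℕ → ℝ} (hp : ∀ k, 0 ≤ p k) {x z S : ℝ} (hx : 0 ≤ x) (hz : 0 ≤ z)
    (hS : HasSum (fun k => p k * z ^ k) S) :
    (z ≠ 0 → ∀ n, Summable fun k : ℕ => x ^ k / (k.factorial : ℝ) * convPow p k n) ∧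
    HasSum (fun n => expCoef p n x * z ^ n) (Real.exp (S * x)) := by
  have he : HasSum (fun k : ℕ => x ^ k / (k.factorial : ℝ) * S ^ k) (Real.exp (S * x)) := by
    have := NormedSpace.expSeries_div_hasSum_exp (𝔸 := ℝ) (S * x)
    rw [← Real.exp_eq_exp_ℝ] at this
    convert! this using 2 with k
    rw [mul_pow]; ring
  exact gen_swap hp (fun k => by positivity) hz hS he

lemma expCoef_meas {p : ℕ → ℝ} (hp : ∀ k, 0 ≤ p k) (h1 : HasSum p 1) (n : ℕ) (Λ : Measure ℝ) :
    AEMeasurable (expCoef p n) (Λ.restrict (Set.Ioi 0)) := by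
  refine aemeasurable_of_tendsto_metrizable_ae Filter.atTop
    (f := fun N x => ∑ k ∈ Finset.range N, x ^ k / (k.factorial : ℝ) * convPow p k n)
    (fun N => by fun_prop) ?_
  filter_upwards [ae_restrict_mem measurableSet_Ioi] with x hx
  exact ((expCoef_hasSum hp (le_of_lt hx) zero_le_one (S := 1)
    (by simpa using h1)).1 one_ne_zero n).hasSum.tendsto_sum_nat

/-- The integrand. -/
noncomputable def igd (α h x : ℝ) : ℝ := (Real.exp ((h - 1) * x) - Real.exp (-x)) * x ^ (-α)

lemma igd_meas (α h : ℝ) : Measurable (igd α h) := by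
  unfold igd; fun_prop

lemma igd_nonneg {α h x : ℝ} (hh : 0 ≤ h) (hx : 0 ≤ x) : 0 ≤ igd α h x := by
  unfold igd
  refine mul_nonneg (sub_nonneg.2 (Real.exp_le_exp.2 (by nlinarith))) (by positivity)

lemma igd_integrable {m : ℝ} (hm0 : 0 < m) (hm1 : m < 1) {Λ : Measure ℝ} (hΛ : IsLocFiniteOnPos Λ)
    (hs : ScaleInvariant m Λ) {α h : ℝ} (hα : α < 1) (hh0 : 0 ≤ h) (hh : h < 1) :
    IntegrableOn (igd α h) (Set.Ioi 0) Λ := by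
  refine ⟨(igd_meas α h).aestronglyMeasurable, ?_⟩
  rw [hasFiniteIntegral_iff_norm]
  refine lt_of_le_of_lt (setLIntegral_mono' measurableSet_Ioi fun x hx => ?_)
    (lint_fin hm0 hm1 hΛ hs (β := 1 - α) (c := 1 - h) (by linarith) (by linarith))
  have hx0 : 0 < x := hx
  refine ENNReal.ofReal_le_ofReal ?_
  rw [Real.norm_of_nonneg (igd_nonneg hh0 hx0.le), igd]
  have h1 : x ^ (1 - α) = x * x ^ (-α) := by
    rw [sub_eq_add_neg, Real.rpow_add hx0, Real.rpow_one]
  have h2 : Real.exp (-x) = Real.exp ((h - 1) * x) * Real.exp (-(h * x)) := by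
    rw [← Real.exp_add]; congr 1; ring
  have h3 : -((1 - h) * x) = (h - 1) * x := by ring
  rw [h1, h2, h3]
  have h4 := Real.add_one_le_exp (-(h * x))
  have h5 : 1 - Real.exp (-(h * x)) ≤ x := by nlinarith
  have h6 : 0 ≤ x ^ (-α) := by positivity
  calc _ = (1 - Real.exp (-(h * x))) * (x ^ (-α) * Real.exp ((h - 1) * x)) := by ring
    _ ≤ x * (x ^ (-α) * Real.exp ((h - 1) * x)) := by gcongr
    _ = _ := by ring

lemma igd_scale {m : ℝ} (hm0 : 0 < m) {Λ : Measure ℝ} (hs : ScaleInvariant m Λ) (α h h' h0 : ℝ)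
    (e1 : h' - 1 = m * (h - 1)) (e0 : h0 - 1 = - m)
    (i1 : IntegrableOn (igd α h') (Set.Ioi 0) Λ) (i0 : IntegrableOn (igd α h0) (Set.Ioi 0) Λ) :
    (∫ x in Set.Ioi 0, igd α h' x ∂Λ) - (∫ x in Set.Ioi 0, igd α h0 x ∂Λ)
      = m ^ α * ∫ x in Set.Ioi 0, igd α h x ∂Λ := by
  rw [← integral_sub i1 i0]
  conv_rhs => rw [← sm_map hm0 hs]
  rw [integral_map (by fun_prop) (igd_meas α h).aestronglyMeasurable, ← integral_const_mul]
  refine setIntegral_congr_fun measurableSet_Ioi fun x hx => ?_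
  have hx0 : 0 < x := hx
  simp only [igd]
  rw [e1, e0, Real.mul_rpow hm0.le hx0.le, Real.rpow_neg hm0.le]
  have : m ^ α ≠ 0 := by positivity
  have e2 : m * (h - 1) * x = (h - 1) * (m * x) := by ring
  rw [e2, neg_mul]
  field_simp
  ring

theorem integral_representation_gives_invariant_measure
    (q : ℕ → ℝ) (hq0 : ∀ k, 0 ≤ q k) (hq1 : HasSum q 1)
    (m : ℝ) (hm : HasSum (fun k : ℕ => (k : ℝ) * q k) m) (hm0 : 0 < m) (hm1 : m < 1)
    (νmin : ℕ → ℝ) (hmin : IsInvMeasure q m νmin) (hmin1 : HasSum νmin 1)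
    (α : ℝ) (hα : α < 1)
    (Λ : Measure ℝ) (hΛ : IsLocFiniteOnPos Λ) (hs : ScaleInvariant m Λ) :
    (∀ z ∈ Set.Ico (0 : ℝ) 1,
      IntegrableOn
        (fun x => (Real.exp (((∑' n, νmin n * z ^ n) - 1) * x) - Real.exp (-x)) * x ^ (-α))
        (Set.Ioi 0) Λ) ∧
    ∃ ν : ℕ → ℝ, IsInvMeasure q (m ^ α) ν ∧
      ∀ z ∈ Set.Ico (0 : ℝ) 1,
        HasSum (fun n => ν n * z ^ n)
          (∫ x in Set.Ioi (0 : ℝ),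
            (Real.exp (((∑' n, νmin n * z ^ n) - 1) * x) - Real.exp (-x)) * x ^ (-α) ∂Λ) := by
  obtain ⟨hν0, hνz, hνinv⟩ := hmin
  set H : ℝ → ℝ := fun z => ∑' n, νmin n * z ^ n with hH
  -- basic facts on H and F
  have hHs : ∀ z ∈ Set.Icc (0:ℝ) 1, HasSum (fun n => νmin n * z ^ n) (H z) := fun z hz =>
    (Summable.of_nonneg_of_le (fun n => mul_nonneg (hν0 n) (pow_nonneg hz.1 n))
      (fun n => mul_le_of_le_one_right (hν0 n) (pow_le_one₀ hz.1 hz.2)) hmin1.summable).hasSum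
  have hH0 : ∀ z ∈ Set.Icc (0:ℝ) 1, 0 ≤ H z := fun z hz =>
    tsum_nonneg fun n => mul_nonneg (hν0 n) (pow_nonneg hz.1 n)
  have hHle : ∀ z ∈ Set.Icc (0:ℝ) 1, H z ≤ z := fun z hz => by
    have h1 := hmin1.mul_right z
    rw [one_mul] at h1
    refine hasSum_le (fun n => ?_) (hHs z hz) h1
    rcases Nat.eq_zero_or_pos n with rfl | hn
    · simp [hνz]
    · exact mul_le_mul_of_nonneg_left (pow_le_of_le_one hz.1 hz.2 hn.ne') (hν0 n)
  have hHone : H 1 = 1 := by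
    have := hHs 1 (by simp)
    simp only [one_pow, mul_one] at this
    exact this.unique hmin1
  have hHzero : H 0 = 0 := le_antisymm (hHle 0 (by simp)) (hH0 0 (by simp))
  set F : ℝ → ℝ := fun z => ∑' n, q n * z ^ n with hF
  have hFs : ∀ z ∈ Set.Icc (0:ℝ) 1, HasSum (fun n => q n * z ^ n) (F z) := fun z hz =>
    (Summable.of_nonneg_of_le (fun n => mul_nonneg (hq0 n) (pow_nonneg hz.1 n))
      (fun n => mul_le_of_le_one_right (hq0 n) (pow_le_one₀ hz.1 hz.2)) hq1.summable).hasSum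
  have hF0 : ∀ z ∈ Set.Icc (0:ℝ) 1, 0 ≤ F z := fun z hz =>
    tsum_nonneg fun n => mul_nonneg (hq0 n) (pow_nonneg hz.1 n)
  have hFone : F 1 = 1 := by
    have := hFs 1 (by simp)
    simp only [one_pow, mul_one] at this
    exact this.unique hq1
  obtain ⟨k0, hk0, hqk0⟩ : ∃ k : ℕ, k ≠ 0 ∧ 0 < q k := by
    by_contra hcon
    push Not at hcon
    have : (fun k : ℕ => (k:ℝ) * q k) = fun _ => 0 := by
      funext k
      rcases eq_or_ne k 0 with rfl | hk
      · simp
      · rw [le_antisymm (hcon k hk) (hq0 k), mul_zero]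
    rw [this] at hm
    exact hm0.ne' (hm.unique hasSum_zero)
  have hF1 : ∀ z ∈ Set.Ico (0:ℝ) 1, F z < 1 := fun z hz => by
    refine hasSum_lt (i := k0) (fun n => ?_) ?_ (hFs z ⟨hz.1, hz.2.le⟩) hq1
    · exact mul_le_of_le_one_right (hq0 n) (pow_le_one₀ hz.1 hz.2.le)
    · exact mul_lt_of_lt_one_right hqk0 (pow_lt_one₀ hz.1 hz.2 hk0)
  have hFle : ∀ z ∈ Set.Icc (0:ℝ) 1, F z ∈ Set.Icc (0:ℝ) 1 := fun z hz => by
    refine ⟨hF0 z hz, ?_⟩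
    rcases hz.2.lt_or_eq with h | h
    · exact (hF1 z ⟨hz.1, h⟩).le
    · rw [h, hFone]
  -- functional equation
  have hfe0 : ∀ z ∈ Set.Icc (0:ℝ) 1, H (F z) = m * H z + ∑' i, νmin i * convPow q i 0 := by
    intro z hz
    have h1 := (gen_swap hq0 hν0 hz.1 (hFs z hz) (hHs (F z) (hFle z hz))).2
    have h2 := ((hHs z hz).mul_left m).add
      (hasSum_ite_eq (0:ℕ) (∑' i, νmin i * convPow q i 0))
    refine h1.unique ?_
    convert! h2 using 2 with j
    rcases Nat.eq_zero_or_pos j with rfl | hj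
    · simp [hνz]
    · rw [(hνinv j hj).2]; simp [hj.ne', mul_assoc]
  have hfe : ∀ z ∈ Set.Icc (0:ℝ) 1, H (F z) - 1 = m * (H z - 1) := by
    intro z hz
    have h1 := hfe0 1 (by simp)
    rw [hFone, hHone] at h1
    rw [hfe0 z hz]; linarith
  have hInt : ∀ z ∈ Set.Ico (0 : ℝ) 1, IntegrableOn (igd α (H z)) (Set.Ioi 0) Λ := fun z hz =>
    igd_integrable hm0 hm1 hΛ hs hα (hH0 z ⟨hz.1, hz.2.le⟩)
      ((hHle z ⟨hz.1, hz.2.le⟩).trans_lt hz.2)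
  -- the measure
  set b : ℕ → ℝ → ℝ := fun n x =>
    if n = 0 then 0 else expCoef νmin n x * (Real.exp (-x) * x ^ (-α)) with hb
  have hb0 : ∀ n, ∀ x ∈ Set.Ioi (0:ℝ), 0 ≤ b n x := fun n x hx => by
    have hx' : 0 < x := hx
    simp only [hb]
    split_ifs
    · exact le_rfl
    · exact mul_nonneg (expCoef_nonneg hν0 n hx'.le) (by positivity)
  have hbs : ∀ z ∈ Set.Icc (0:ℝ) 1, ∀ x ∈ Set.Ioi (0:ℝ),
      HasSum (fun n => b n x * z ^ n) (igd α (H z) x) := by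
    intro z hz x hx
    have hx' : 0 < x := hx
    have h0 : expCoef νmin 0 x = 1 := by
      have h1 := (expCoef_hasSum hν0 hx'.le le_rfl (hHs 0 (by simp))).2
      rw [hHzero, zero_mul, Real.exp_zero] at h1
      refine (hasSum_single 0 ?_).unique h1 |> fun h => by simpa using h
      intro n hn; simp [hn]
    have h1 := ((expCoef_hasSum hν0 hx'.le hz.1 (hHs z hz)).2.sub
      (hasSum_ite_eq (0:ℕ) (1:ℝ))).mul_right (Real.exp (-x) * x ^ (-α))
    have h2 : igd α (H z) x = (Real.exp (H z * x) - 1) * (Real.exp (-x) * x ^ (-α)) := by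
      rw [igd]
      have : Real.exp ((H z - 1) * x) = Real.exp (H z * x) * Real.exp (-x) := by
        rw [← Real.exp_add]; congr 1; ring
      rw [this]; ring
    rw [h2]
    convert! h1 using 2 with n
    · simp only [hb]
      split_ifs with hn
      · subst hn; simp [h0]
      · ring
  have hbm : ∀ n, AEStronglyMeasurable (b n) (Λ.restrict (Set.Ioi 0)) := fun n => by
    simp only [hb]
    split_ifs
    · exact aestronglyMeasurable_const
    · exact ((expCoef_meas hν0 hmin1 n Λ).mul (by fun_prop)).aestronglyMeasurable
  set ν : ℕ → ℝ := fun n => ∫ x in Set.Ioi (0:ℝ), b n x ∂Λ with hν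
  have hνs : ∀ z ∈ Set.Ico (0:ℝ) 1,
      HasSum (fun n => ν n * z ^ n) (∫ x in Set.Ioi (0:ℝ), igd α (H z) x ∂Λ) := by
    intro z hz
    have hz' : z ∈ Set.Icc (0:ℝ) 1 := ⟨hz.1, hz.2.le⟩
    have := hasSum_integral_of_dominated_convergence (μ := Λ.restrict (Set.Ioi 0))
      (F := fun n x => b n x * z ^ n) (f := igd α (H z)) (fun n x => b n x * z ^ n)
      (fun n => (hbm n).mul_const _) (fun n => ?_) ?_ ?_ ?_
    · simpa only [integral_mul_const] using this
    · filter_upwards [ae_restrict_mem measurableSet_Ioi] with x hx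
      exact (Real.norm_of_nonneg (mul_nonneg (hb0 n x hx) (pow_nonneg hz.1 n))).le
    · filter_upwards [ae_restrict_mem measurableSet_Ioi] with x hx
      exact (hbs z hz' x hx).summable
    · refine (hInt z hz).congr ?_
      filter_upwards [ae_restrict_mem measurableSet_Ioi] with x hx
      exact (hbs z hz' x hx).tsum_eq.symm
    · filter_upwards [ae_restrict_mem measurableSet_Ioi] with x hx
      exact hbs z hz' x hx
  have hνnn : ∀ n, 0 ≤ ν n := fun n => setIntegral_nonneg measurableSet_Ioi (hb0 n)
  have hν00 : ν 0 = 0 := by simp [hν, hb]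
  have hFm : ∀ z ∈ Set.Ico (0:ℝ) 1, F z ∈ Set.Ico (0:ℝ) 1 := fun z hz =>
    ⟨hF0 z ⟨hz.1, hz.2.le⟩, hF1 z hz⟩
  have hgs : ∀ z ∈ Set.Ico (0:ℝ) 1, _ := fun z hz =>
    gen_swap hq0 hνnn hz.1 (hFs z ⟨hz.1, hz.2.le⟩) (hνs (F z) (hFm z hz))
  have h00 : (0:ℝ) ∈ Set.Ico (0:ℝ) 1 := by simp
  refine ⟨hInt, ν, ⟨hνnn, hν00, ?_⟩, hνs⟩
  have hc0 : ∑' i, ν i * convPow q i 0 = ∫ x in Set.Ioi (0:ℝ), igd α (H (F 0)) x ∂Λ := by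
    refine (hasSum_single 0 ?_).unique (hgs 0 h00).2 |> fun h => by simpa using h
    intro n hn; simp [hn]
  have hu := coeff_unique (a := fun j => (∑' i, ν i * convPow q i j) - m ^ α * ν j
      - if j = 0 then ∑' i, ν i * convPow q i 0 else 0) (fun z hz => by
    have hz' : z ∈ Set.Ico (0:ℝ) 1 := ⟨hz.1.le, hz.2⟩
    have h1 := ((hgs z hz').2.sub ((hνs z hz').mul_left (m ^ α))).sub
      (hasSum_ite_eq (0:ℕ) (∑' i, ν i * convPow q i 0))
    have h2 := igd_scale hm0 hs α (H z) (H (F z)) (H (F 0)) (hfe z ⟨hz'.1, hz'.2.le⟩)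
      (by rw [hfe 0 (by simp), hHzero]; ring) (hInt _ (hFm z hz')) (hInt _ (hFm 0 h00))
    convert! h1 using 2 with j
    · rcases Nat.eq_zero_or_pos j with rfl | hj
      · simp
      · simp [hj.ne']; ring
    · rw [hc0, ← h2]; ring)
  intro j hj
  refine ⟨(hgs (1/2) (by norm_num)).1 (by norm_num) j, ?_⟩
  have := hu j
  simp only [if_neg (by omega : j ≠ 0)] at this
  linarith
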